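/- arXiv:2205.10754 — 3 statements merged into one kernel-verified Lean document; each statement's English description precedes it below -/
import Mathlib

section
/- Let K be an imaginary quadratic field and O an order in K of discriminant D_O with class number h_O ≥ 2. Let Q = ax² + bxy + cy² be a reduced form in Q(D_O) with Q ≠ Q₀. Then |g_{[0,1/2]}(ω_Q)| > 1.98 · e^{−π√|D_O|/24}. -/
open scoped nonZeroDivisors

set_option synthInstance.maxHeartbeats 1000000
set_option maxHeartbeats 1000000

noncomputable section

/-- `√D := i√|D|` for a negative integer `D`. -/
def sqrtD (D : ℤ) : ℂ := Complex.I * Real.sqrt (Int.natAbs D)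

/-- `τ_O`: `√D/2` if `D ≡ 0 (mod 4)`, and `(-1+√D)/2` if `D ≡ 1 (mod 4)`. -/
def tauD (D : ℤ) : ℂ := if D % 4 = 0 then sqrtD D / 2 else (-1 + sqrtD D) / 2

/-- The order `O = ℤτ_O + ℤ = ℤ[τ_O]` of discriminant `D` in the imaginary quadratic field
`K = ℚ(√D) ⊆ ℂ`. -/
def OD (D : ℤ) : Subalgebra ℤ ℂ := Algebra.adjoin ℤ {tauD D}

/-- Fractional `O`-ideals (inside `ℂ ⊇ K`; every fractional `O`-ideal lies in `K`). -/
abbrev Frac (O : Subalgebra ℤ ℂ) := FractionalIdeal ((O : Type))⁰ ℂ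

/-- A nonzero ideal `a` of `O` is *prime to* `m` if `a + mO = O`. -/
def primeTo (O : Subalgebra ℤ ℂ) (m : ℕ) (a : Ideal O) : Prop :=
  a ⊔ Ideal.span {(m : (O : Type))} = ⊤

/-- `M(O, m)`: the nonzero proper (equivalently, invertible) `O`-ideals prime to `m`. -/
def Mset (O : Subalgebra ℤ ℂ) (m : ℕ) : Set (Ideal O) :=
  {a | a ≠ 0 ∧ primeTo O m a ∧ IsUnit (a : Frac O)}

/-- `I(O, m)`: the subgroup of invertible fractional `O`-ideals generated by `M(O, m)`. -/
def Igrp (O : Subalgebra ℤ ℂ) (m : ℕ) : Subgroup (Frac O)ˣ :=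
  Subgroup.closure {u | ∃ a ∈ Mset O m, (u : Frac O) = a}

/-- `P_N(O)`: the subgroup generated by the principal ideals `νO` with `ν ∈ O` nonzero and
`ν ≡ 1 (mod NO)`. -/
def Pgrp (O : Subalgebra ℤ ℂ) (N : ℕ) : Subgroup (Frac O)ˣ :=
  Subgroup.closure {u | ∃ ν : (O : Type), ν ≠ 0 ∧
    (∃ μ : (O : Type), ν = 1 + (N : (O : Type)) * μ) ∧
    (u : Frac O) = ((Ideal.span {ν} : Ideal O) : Frac O)}

/-- The ray class group `C_N(O) = I(O, N)/P_N(O)`. -/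
abbrev ClsGrp (O : Subalgebra ℤ ℂ) (N : ℕ) :=
  (Igrp O N) ⧸ ((Pgrp O N).subgroupOf (Igrp O N))

/-- The underlying set (in `ℂ`) of an invertible fractional ideal. -/
def fracSet {O : Subalgebra ℤ ℂ} (u : (Frac O)ˣ) : Set ℂ :=
  (((u : Frac O) : Submodule (O : Type) ℂ) : Set ℂ)

/-- An integral binary quadratic form `a x² + b x y + c y²`. -/
structure QF where
  a : ℤ
  b : ℤ
  c : ℤ

/-- The discriminant `b² - 4ac`. -/
def QF.disc (Q : QF) : ℤ := Q.b ^ 2 - 4 * Q.a * Q.c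

/-- `Q ∈ 𝒬(D)`: primitive positive definite of discriminant `D`. -/
def IsForm (D : ℤ) (Q : QF) : Prop :=
  Int.gcd Q.a (Int.gcd Q.b Q.c) = 1 ∧ Q.disc = D ∧ 0 < Q.a

/-- `Q ∈ 𝒬(D, N)`: additionally `gcd(a, N) = 1`. -/
def IsFormN (D : ℤ) (N : ℕ) (Q : QF) : Prop := IsForm D Q ∧ Int.gcd Q.a N = 1

/-- `ω_Q = (-b + √D)/(2a)`, the root of `Q(x, 1)` in the upper half-plane. -/
def omegaQ (D : ℤ) (Q : QF) : ℂ := (-(Q.b : ℂ) + sqrtD D) / (2 * Q.a)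

/-- The lattice `ℤω + ℤ`, as a subset of `ℂ`. -/
def latticeSet (ω : ℂ) : Set ℂ := {z : ℂ | ∃ m n : ℤ, z = (m : ℂ) * ω + (n : ℂ)}

/-- `P(O)`: the subgroup of principal fractional `O`-ideals (generated by the nonzero
principal integral ideals). -/
def PprinAll (O : Subalgebra ℤ ℂ) : Subgroup (Frac O)ˣ :=
  Subgroup.closure {u | ∃ ν : (O : Type), ν ≠ 0 ∧
    (u : Frac O) = ((Ideal.span {ν} : Ideal O) : Frac O)}

/-- The class number `h_O = |C(O)| = |I(O)/P(O)|`. -/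
def classNum (O : Subalgebra ℤ ℂ) : ℕ := Nat.card ((Frac O)ˣ ⧸ PprinAll O)

/-- A reduced form: `|b| ≤ a ≤ c`, with `b ≥ 0` if `|b| = a` or `a = c`. -/
def IsReducedQF (Q : QF) : Prop :=
  |Q.b| ≤ Q.a ∧ Q.a ≤ Q.c ∧ ((|Q.b| = Q.a ∨ Q.a = Q.c) → 0 ≤ Q.b)

/-- The principal form `Q₀` of discriminant `D`. -/
def Q0 (D : ℤ) : QF := if D % 4 = 0 then ⟨1, 0, -(D / 4)⟩ else ⟨1, 1, (1 - D) / 4⟩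

/-- The Siegel function `g_{[0,1/2]}(τ) = -q^{1/12} e^{-πi/2} (1 - q_z)
∏_{n≥1} (1 - qⁿ q_z)(1 - qⁿ q_z⁻¹)` with `q = e^{2πiτ}` and `q_z = e^{2πi·(1/2)} = -1`,
so that `g_{[0,1/2]}(τ) = -q^{1/12} e^{-πi/2} · 2 · ∏_{n≥1} (1 + qⁿ)²`. -/
def g0half (τ : ℂ) : ℂ :=
  -Complex.exp (2 * Real.pi * Complex.I * τ / 12) * Complex.exp (-(Real.pi * Complex.I) / 2)
    * 2 * ∏' n : ℕ, (1 + Complex.exp (2 * Real.pi * Complex.I * τ) ^ (n + 1)) ^ 2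

/-!
STATEMENT 12: if `h_O ≥ 2` and `Q = ax² + bxy + cy²` is a reduced form in `𝒬(D_O)` with
`Q ≠ Q₀`, then `|g_{[0,1/2]}(ω_Q)| > 1.98 e^{-π√|D_O|/24}`.
-/

/-- A Weierstrass product inequality. -/
theorem one_sub_sum_norm_le_norm_prod_one_add {ι : Type*} (s : Finset ι) (f : ι → ℂ)
    (hf : ∀ i ∈ s, ‖f i‖ ≤ 1) : 1 - ∑ i ∈ s, ‖f i‖ ≤ ‖∏ i ∈ s, (1 + f i)‖ := by
  classical
  induction s using Finset.induction_on with
  | empty => simp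
  | insert i s hi ih =>
    have ih := ih fun j hj => hf j (Finset.mem_insert_of_mem hj)
    have hi1 := hf i (Finset.mem_insert_self i s)
    rw [Finset.sum_insert hi, Finset.prod_insert hi, norm_mul]
    have h1 : 1 - ‖f i‖ ≤ ‖1 + f i‖ := by
      have := norm_sub_le (1 + f i) (f i)
      simp only [add_sub_cancel_right, norm_one] at this
      linarith
    have hS : 0 ≤ ∑ j ∈ s, ‖f j‖ := Finset.sum_nonneg fun j _ => norm_nonneg _
    have h2 := mul_le_mul_of_nonneg_right h1 (norm_nonneg (∏ j ∈ s, (1 + f j)))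
    have h3 := mul_le_mul_of_nonneg_left ih (sub_nonneg.2 hi1)
    nlinarith [norm_nonneg (f i)]

theorem norm_tprod_one_add_pow_sq_ge {q : ℂ} (hq : ‖q‖ < 1) (hr : ‖q‖ / (1 - ‖q‖) ≤ 1) :
    (1 - ‖q‖ / (1 - ‖q‖)) ^ 2 ≤ ‖∏' n : ℕ, (1 + q ^ (n + 1)) ^ 2‖ := by
  have hsum : HasSum (fun n : ℕ => ‖q ^ (n + 1)‖) (‖q‖ / (1 - ‖q‖)) := by
    have := (hasSum_geometric_of_lt_one (norm_nonneg q) hq).mul_left ‖q‖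
    simpa only [norm_pow, norm_mul, pow_succ', div_eq_mul_inv] using this
  have hprod := ((multipliable_one_add_of_summable hsum.summable).hasProd.mul
    (multipliable_one_add_of_summable hsum.summable).hasProd).multipliable
  simp only [← sq] at hprod
  refine ge_of_tendsto' hprod.hasProd.tendsto_prod_nat.norm fun N => ?_
  have h1 : ∑ i ∈ Finset.range N, ‖q ^ (i + 1)‖ ≤ ‖q‖ / (1 - ‖q‖) :=
    sum_le_hasSum _ (fun _ _ => norm_nonneg _) hsum
  have h2 := one_sub_sum_norm_le_norm_prod_one_add (Finset.range N) (fun i => q ^ (i + 1))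
    fun i _ => by rw [norm_pow]; exact pow_le_one₀ (norm_nonneg q) hq.le
  rw [Finset.prod_pow, norm_pow]
  exact pow_le_pow_left₀ (by linarith) (by linarith) 2

theorem exp_five_point_four_gt : (201 : ℝ) < Real.exp 5.4 := by
  have h1 : Real.exp 5.4 = Real.exp 1 ^ 5 * Real.exp 0.4 := by
    rw [← Real.exp_nat_mul, ← Real.exp_add]; norm_num
  have h2 : (2.71 : ℝ) ^ 5 ≤ Real.exp 1 ^ 5 :=
    pow_le_pow_left₀ (by norm_num) (by linarith [Real.exp_one_gt_d9]) 5
  have h3 : (1.4 : ℝ) ≤ Real.exp 0.4 := by linarith [Real.add_one_le_exp (0.4 : ℝ)]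
  rw [h1]
  exact lt_of_lt_of_le (by norm_num) (mul_le_mul h2 h3 (by norm_num) (by positivity))

/-- A reduced form with leading coefficient `1` is principal. -/
theorem eq_Q0_of_isReducedQF {D : ℤ} {Q : QF} (hdisc : Q.disc = D) (hred : IsReducedQF Q)
    (ha : Q.a = 1) : Q = Q0 D := by
  obtain ⟨a, b, c⟩ := Q
  obtain ⟨h1, -, h3⟩ := hred
  simp only at ha h1 h3
  subst ha
  obtain ⟨hb1, hb2⟩ := abs_le.1 h1
  have hb : b = 0 ∨ b = 1 := by
    rcases (by omega : b = -1 ∨ b = 0 ∨ b = 1) with rfl | h | h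
    · exact absurd (h3 (Or.inl (by norm_num))) (by norm_num)
    · exact Or.inl h
    · exact Or.inr h
  simp only [QF.disc] at hdisc
  rcases hb with rfl | rfl
  · rw [Q0, if_pos (by omega), QF.mk.injEq]
    omega
  · rw [Q0, if_neg (by omega), QF.mk.injEq]
    omega

/-- A reduced form of discriminant `D` satisfies `3 a² ≤ |D|`. -/
theorem three_mul_sq_le_natAbs_disc {Q : QF} (ha : 0 < Q.a) (hred : IsReducedQF Q) :
    3 * Q.a ^ 2 ≤ (Q.disc.natAbs : ℤ) := by
  obtain ⟨h1, h2, -⟩ := hred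
  have h3 : Q.b ^ 2 ≤ Q.a ^ 2 := sq_le_sq.2 (by rwa [abs_of_pos ha])
  rw [Int.natCast_natAbs]
  refine le_trans ?_ (neg_le_abs _)
  rw [QF.disc]
  nlinarith

theorem omegaQ_im (D : ℤ) (Q : QF) :
    (omegaQ D Q).im = Real.sqrt (Int.natAbs D) / (2 * Q.a) := by
  have h : omegaQ D Q =
      (((-Q.b / (2 * Q.a) : ℝ) : ℂ) + ((Real.sqrt (Int.natAbs D) / (2 * Q.a) : ℝ) : ℂ)
        * Complex.I) := by
    rw [omegaQ, sqrtD]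
    push_cast
    ring
  rw [h, Complex.add_im, Complex.ofReal_im, Complex.im_ofReal_mul, Complex.I_im]
  ring

theorem norm_exp_two_pi_I_mul_div (τ : ℂ) (x : ℝ) :
    ‖Complex.exp (2 * Real.pi * Complex.I * τ / x)‖ = Real.exp (-(2 * Real.pi * τ.im) / x) := by
  rw [Complex.norm_exp, Complex.div_ofReal_re]
  congr 2
  simp [Complex.mul_re, Complex.mul_im]

theorem norm_g0half (τ : ℂ) :
    ‖g0half τ‖ = 2 * Real.exp (-(2 * Real.pi * τ.im) / 12) *
      ‖∏' n : ℕ, (1 + Complex.exp (2 * Real.pi * Complex.I * τ) ^ (n + 1)) ^ 2‖ := by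
  have h1 := norm_exp_two_pi_I_mul_div τ 12
  have h2 : ‖Complex.exp (-(Real.pi * Complex.I) / 2)‖ = 1 := by
    rw [Complex.norm_exp]; simp
  push_cast at h1
  rw [g0half, norm_mul, norm_mul, norm_mul, norm_neg, h1, h2, Complex.norm_two]
  ring

theorem statement12 (D : ℤ) (hD : D < 0) (hD4 : D % 4 = 0 ∨ D % 4 = 1)
    (hclass : 2 ≤ classNum (OD D))
    (Q : QF) (hQ : IsForm D Q) (hred : IsReducedQF Q) (hne : Q ≠ Q0 D) :
    1.98 * Real.exp (-(Real.pi * Real.sqrt (Int.natAbs D)) / 24) <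
      ‖g0half (omegaQ D Q)‖ := by
  obtain ⟨-, hdisc, ha⟩ := hQ
  have ha2 : (2 : ℝ) ≤ Q.a := by
    have : Q.a ≠ 1 := fun h => hne (eq_Q0_of_isReducedQF hdisc hred h)
    exact_mod_cast (by omega : 2 ≤ Q.a)
  have ha0 : (0 : ℝ) < Q.a := by linarith
  have h3 := three_mul_sq_le_natAbs_disc ha hred
  rw [hdisc] at h3
  have h3' : 3 * (Q.a : ℝ) ^ 2 ≤ (Int.natAbs D : ℝ) := by
    rw [← Int.cast_natCast (R := ℝ)]
    exact_mod_cast (Int.cast_le (R := ℝ)).2 h3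
  set s := Real.sqrt (Int.natAbs D) with hs
  have hs0 : 0 ≤ s := Real.sqrt_nonneg _
  have hs1 : 1.73 * Q.a ≤ s := Real.le_sqrt_of_sq_le (by nlinarith)
  have hpi := Real.pi_gt_d2
  have hexp : 2 * Real.pi * (omegaQ D Q).im = Real.pi * s / Q.a := by
    rw [omegaQ_im, ← hs]; field_simp
  have hlarge : 5.4 ≤ Real.pi * s / Q.a := by
    rw [le_div_iff₀ ha0]
    nlinarith
  have hq : ‖Complex.exp (2 * Real.pi * Complex.I * omegaQ D Q)‖ ≤ 1 / 201 := by
    have h := norm_exp_two_pi_I_mul_div (omegaQ D Q) 1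
    simp only [Complex.ofReal_one, div_one] at h
    rw [h, hexp, Real.exp_neg, one_div]
    exact inv_anti₀ (by norm_num) (exp_five_point_four_gt.le.trans (Real.exp_le_exp.2 hlarge))
  set q := Complex.exp (2 * Real.pi * Complex.I * omegaQ D Q) with hqdef
  have hr : ‖q‖ / (1 - ‖q‖) ≤ 0.005 := by
    rw [div_le_iff₀ (by linarith)]
    linarith
  have hprod := norm_tprod_one_add_pow_sq_ge (q := q) (by linarith) (by linarith)
  have hprod' : (0.99 : ℝ) < ‖∏' n : ℕ, (1 + q ^ (n + 1)) ^ 2‖ :=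
    lt_of_lt_of_le (by nlinarith) hprod
  have hmono : Real.exp (-(Real.pi * s) / 24) ≤
      Real.exp (-(2 * Real.pi * (omegaQ D Q).im) / 12) := by
    rw [hexp, Real.exp_le_exp]
    have : Real.pi * s / Q.a ≤ Real.pi * s / 2 :=
      div_le_div_of_nonneg_left (by positivity) (by norm_num) ha2
    linarith
  rw [norm_g0half]
  have hE := Real.exp_pos (-(2 * Real.pi * (omegaQ D Q).im) / 12)
  calc 1.98 * Real.exp (-(Real.pi * s) / 24)
      ≤ 2 * Real.exp (-(2 * Real.pi * (omegaQ D Q).im) / 12) * 0.99 := by linarith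
    _ < _ := mul_lt_mul_of_pos_left hprod' (by positivity)
end
end

section
/- Let K be an imaginary quadratic field and O an order in K of discriminant D_O with class number h_O ≥ 2. Let Q be a reduced form in Q(D_O) with Q ≠ Q₀. Then |j(ω_Q)²(j(ω_Q) − 1728)³| / |j(ω_{Q₀})²(j(ω_{Q₀}) − 1728)³| < 877383 · e^{−5π√|D_O|/2}, and this bound is less than 1. -/
open scoped nonZeroDivisors

set_option synthInstance.maxHeartbeats 1000000
set_option maxHeartbeats 1000000

noncomputable section

/-- The modular `j`-invariant, via `j = (g_{[0,1/2]}^{12} + 16)³ / g_{[0,1/2]}^{12}`. -/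
def jinv (τ : ℂ) : ℂ := (g0half τ ^ 12 + 16) ^ 3 / g0half τ ^ 12

lemma norm_tprod_one_add_sub_one_le {ι : Type*} {f : ι → ℂ} (hf : Summable fun i ↦ ‖f i‖) :
    ‖∏' i, (1 + f i) - 1‖ ≤ Real.exp (∑' i, ‖f i‖) - 1 := by
  have h : Filter.Tendsto (fun t : Finset ι ↦ ∏ i ∈ t, (1 + f i)) Filter.atTop
      (nhds (∏' i, (1 + f i))) := (multipliable_one_add_of_summable hf).hasProd
  refine le_of_tendsto (h.sub_const 1).norm
    (Filter.Eventually.of_forall fun t ↦ (t.norm_prod_one_add_sub_one_le f).trans ?_)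
  gcongr
  exact hf.sum_le_tsum t fun i _ ↦ norm_nonneg _

lemma exists_g0half_pow_eq (τ : ℂ) {x : ℝ} (hx : 220 ≤ x)
    (hq : ‖Complex.exp (2 * Real.pi * Complex.I * τ)‖ = x⁻¹) :
    ∃ h : ℂ, g0half τ ^ 12 = 4096 * h ∧ 0.89 * x⁻¹ ≤ ‖h‖ ∧ ‖h‖ ≤ 1.12 * x⁻¹ := by
  set q := Complex.exp (2 * Real.pi * Complex.I * τ) with hqdef
  have hx0 : 0 < x := by linarith
  have hxinv : x⁻¹ ≤ 1 / 220 := by rw [inv_eq_one_div]; gcongr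
  have hxpos : 0 < x⁻¹ := by positivity
  have hlt : ‖q‖ < 1 := by rw [hq]; linarith
  have hsum : Summable fun n : ℕ ↦ ‖q ^ (n + 1)‖ := by
    simp_rw [norm_pow]
    exact (summable_nat_add_iff 1).2 (summable_geometric_of_lt_one (norm_nonneg _) hlt)
  have hmul : Multipliable fun n : ℕ ↦ 1 + q ^ (n + 1) := multipliable_one_add_of_summable hsum
  set p := ∏' n : ℕ, (1 + q ^ (n + 1)) with hp
  have htsum : ∑' n : ℕ, ‖q ^ (n + 1)‖ ≤ 1 / 219 := by
    simp_rw [norm_pow, pow_succ]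
    rw [tsum_mul_right, tsum_geometric_of_lt_one (norm_nonneg _) hlt, hq, inv_mul_eq_div,
      div_le_iff₀ (by linarith)]
    linarith
  have hexp : Real.exp (1 / 219) ≤ 1 + 1 / 218 := by
    have := Real.one_sub_le_exp_neg (1 / 219)
    rw [Real.exp_neg] at this
    have h2 := inv_anti₀ (by norm_num) this
    rw [inv_inv] at h2
    norm_num at h2 ⊢
    exact h2
  have hp1 : ‖p - 1‖ ≤ 1 / 218 := by
    have := norm_tprod_one_add_sub_one_le hsum
    have h2 := Real.exp_le_exp.2 htsum
    linarith
  have hpu : ‖p‖ ≤ 219 / 218 := by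
    have := norm_add_le (p - 1) 1
    rw [sub_add_cancel, norm_one] at this
    linarith
  have hpl : 217 / 218 ≤ ‖p‖ := by
    have := norm_sub_norm_le (1 : ℂ) p
    rw [norm_one, norm_sub_rev] at this
    linarith
  refine ⟨q * p ^ 24, ?_, ?_, ?_⟩
  · have hprod : ∏' n : ℕ, (1 + q ^ (n + 1)) ^ 2 = p ^ 2 := hmul.tprod_pow 2
    have h1 : Complex.exp (2 * Real.pi * Complex.I * τ / 12) ^ 12 = q := by
      rw [← Complex.exp_nat_mul, hqdef]
      congr 1
      push_cast
      ring
    have h2 : Complex.exp (-(Real.pi * Complex.I) / 2) ^ 12 = 1 := by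
      rw [← Complex.exp_nat_mul, Complex.exp_eq_one_iff]
      exact ⟨-3, by push_cast; ring⟩
    rw [g0half, ← hqdef, hprod, mul_pow, mul_pow, mul_pow, neg_pow, h1, h2]
    ring
  · rw [norm_mul, norm_pow, hq, mul_comm]
    gcongr
    calc (0.89 : ℝ) ≤ (217 / 218) ^ 24 := by norm_num
      _ ≤ _ := by gcongr
  · rw [norm_mul, norm_pow, hq, mul_comm]
    gcongr
    calc ‖p‖ ^ 24 ≤ (219 / 218) ^ 24 := by gcongr
      _ ≤ _ := by norm_num

lemma jinv_expr_eq {τ h : ℂ} (hg : g0half τ ^ 12 = 4096 * h) (hh : h ≠ 0) :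
    jinv τ ^ 2 * (jinv τ - 1728) ^ 3 =
      (1 + 256 * h) ^ 6 * (1 + 64 * h) ^ 3 * (1 + 512 * -h) ^ 6 * h⁻¹ ^ 5 := by
  have h1 : jinv τ = (1 + 256 * h) ^ 3 * h⁻¹ := by
    rw [jinv, hg]; field_simp; ring
  have h2 : jinv τ - 1728 = (1 + 64 * h) * (1 + 512 * -h) ^ 2 * h⁻¹ := by
    rw [h1]; field_simp; ring
  rw [h2, h1]
  ring

lemma norm_one_add_mul_le {h : ℂ} {t : ℝ} (ht : ‖h‖ ≤ t) {c : ℝ} (hc : 0 ≤ c) :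
    ‖1 + c * h‖ ≤ 1 + c * t := by
  calc ‖1 + c * h‖ ≤ ‖(1 : ℂ)‖ + ‖(c : ℂ) * h‖ := norm_add_le _ _
    _ = 1 + c * ‖h‖ := by rw [norm_one, norm_mul, Complex.norm_of_nonneg hc]
    _ ≤ _ := by gcongr

lemma le_norm_one_add_mul {h : ℂ} {t : ℝ} (ht : ‖h‖ ≤ t) {c : ℝ} (hc : 0 ≤ c) :
    1 - c * t ≤ ‖1 + c * h‖ := by
  have h1 := norm_sub_le_norm_add (1 : ℂ) (c * h)
  rw [norm_one, norm_mul, Complex.norm_of_nonneg hc] at h1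
  have h2 : c * ‖h‖ ≤ c * t := by gcongr
  linarith

lemma norm_jinv_expr_le {τ h : ℂ} (hg : g0half τ ^ 12 = 4096 * h) (hh : h ≠ 0) {t s : ℝ}
    (ht : ‖h‖ ≤ t) (hs : ‖h‖⁻¹ ≤ s) :
    ‖jinv τ ^ 2 * (jinv τ - 1728) ^ 3‖ ≤
      (1 + 256 * t) ^ 6 * (1 + 64 * t) ^ 3 * (1 + 512 * t) ^ 6 * s ^ 5 := by
  have ht0 : 0 ≤ t := (norm_nonneg h).trans ht
  have h1 := norm_one_add_mul_le ht (c := 256) (by norm_num)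
  have h2 := norm_one_add_mul_le ht (c := 64) (by norm_num)
  have h3 := norm_one_add_mul_le (h := -h) (t := t) (by rwa [norm_neg]) (c := 512) (by norm_num)
  push_cast at h1 h2 h3
  rw [jinv_expr_eq hg hh]
  simp only [norm_mul, norm_pow, norm_inv] at *
  gcongr

lemma le_norm_jinv_expr {τ h : ℂ} (hg : g0half τ ^ 12 = 4096 * h) (hh : h ≠ 0) {t s : ℝ}
    (ht : ‖h‖ ≤ t) (ht1 : 512 * t ≤ 1) (hs0 : 0 ≤ s) (hs : s ≤ ‖h‖⁻¹) :
    (1 - 256 * t) ^ 6 * (1 - 64 * t) ^ 3 * (1 - 512 * t) ^ 6 * s ^ 5 ≤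
      ‖jinv τ ^ 2 * (jinv τ - 1728) ^ 3‖ := by
  have ht0 : 0 ≤ t := (norm_nonneg h).trans ht
  have h1 := le_norm_one_add_mul ht (c := 256) (by norm_num)
  have h2 := le_norm_one_add_mul ht (c := 64) (by norm_num)
  have h3 := le_norm_one_add_mul (h := -h) (t := t) (by rwa [norm_neg]) (c := 512) (by norm_num)
  have h4 : 0 ≤ 1 - 256 * t := by linarith
  have h5 : 0 ≤ 1 - 64 * t := by linarith
  have h6 : 0 ≤ 1 - 512 * t := by linarith
  push_cast at h1 h2 h3
  rw [jinv_expr_eq hg hh]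
  simp only [norm_mul, norm_pow, norm_inv] at *
  gcongr

lemma norm_jinv_expr_le_of_large {τ : ℂ} {x y : ℝ} (hx : 220 ≤ x) (hy : 400 ≤ y) (hxy : x ≤ y)
    (hq : ‖Complex.exp (2 * Real.pi * Complex.I * τ)‖ = x⁻¹) :
    ‖jinv τ ^ 2 * (jinv τ - 1728) ^ 3‖ ≤ 240000 * y ^ 5 := by
  obtain ⟨h, hg, hl, hu⟩ := exists_g0half_pow_eq τ hx hq
  have hx0 : 0 < x := by linarith
  have hpos : 0 < ‖h‖ := lt_of_lt_of_le (by positivity) hl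
  have hh : h ≠ 0 := norm_pos_iff.1 hpos
  have hinv : ‖h‖⁻¹ ≤ x / 0.89 := by
    have := inv_anti₀ (by positivity) hl
    rwa [mul_inv, inv_inv, mul_comm, ← div_eq_mul_inv] at this
  rcases le_total 280 x with hx' | hx'
  · have ht : ‖h‖ ≤ 1.12 * (280 : ℝ)⁻¹ := hu.trans (by gcongr)
    refine (norm_jinv_expr_le hg hh ht (hinv.trans (by gcongr : x / 0.89 ≤ y / 0.89))).trans ?_
    rw [div_pow, mul_div_assoc', div_le_iff₀ (by norm_num), mul_right_comm (240000 : ℝ)]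
    exact mul_le_mul_of_nonneg_right (by norm_num) (by positivity)
  · have ht : ‖h‖ ≤ 1.12 * (220 : ℝ)⁻¹ := hu.trans (by gcongr)
    have hs : ‖h‖⁻¹ ≤ (0.7 / 0.89) * y := hinv.trans (by
      rw [div_mul_eq_mul_div]; gcongr; linarith)
    refine (norm_jinv_expr_le hg hh ht hs).trans ?_
    rw [mul_pow, ← mul_assoc]
    gcongr
    norm_num

lemma le_norm_jinv_expr_of_large {τ : ℂ} {x : ℝ} (hx : 160000 ≤ x)
    (hq : ‖Complex.exp (2 * Real.pi * Complex.I * τ)‖ = x⁻¹) :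
    0.54 * x ^ 5 ≤ ‖jinv τ ^ 2 * (jinv τ - 1728) ^ 3‖ := by
  obtain ⟨h, hg, hl, hu⟩ := exists_g0half_pow_eq τ (by linarith) hq
  have hx0 : 0 < x := by linarith
  have hpos : 0 < ‖h‖ := lt_of_lt_of_le (by positivity) hl
  have ht : ‖h‖ ≤ 1.12 * (160000 : ℝ)⁻¹ := hu.trans (by gcongr)
  have hs : (1.12 : ℝ)⁻¹ * x ≤ ‖h‖⁻¹ := by
    have := inv_anti₀ hpos hu
    rwa [mul_inv, inv_inv] at this
  refine le_trans ?_ (le_norm_jinv_expr hg (norm_pos_iff.1 hpos) ht (by norm_num)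
    (by positivity) hs)
  rw [mul_pow, ← mul_assoc]
  gcongr
  norm_num

lemma norm_exp_omegaQ (D : ℤ) {Q : QF} (ha : 0 < Q.a) :
    ‖Complex.exp (2 * Real.pi * Complex.I * omegaQ D Q)‖ =
      (Real.exp (Real.pi * Real.sqrt (Int.natAbs D) / Q.a))⁻¹ := by
  have ha' : (Q.a : ℝ) ≠ 0 := by exact_mod_cast ha.ne'
  have haC : (Q.a : ℂ) ≠ 0 := by exact_mod_cast ha.ne'
  have h : 2 * Real.pi * Complex.I * omegaQ D Q =
      ((-(Real.pi * Real.sqrt (Int.natAbs D) / Q.a) : ℝ) : ℂ) +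
        ((-(Real.pi * Q.b / Q.a) : ℝ) : ℂ) * Complex.I := by
    rw [omegaQ, sqrtD]
    push_cast
    field_simp
    linear_combination (Real.sqrt (Int.natAbs D) : ℂ) * Complex.I_sq
  rw [h, Complex.norm_exp, ← Real.exp_neg]
  simp

lemma Q0_a (D : ℤ) : (Q0 D).a = 1 := by
  unfold Q0; split_ifs <;> rfl

lemma two_le_a_of_ne_Q0 {D : ℤ} {Q : QF} (hQ : IsForm D Q) (hred : IsReducedQF Q)
    (hne : Q ≠ Q0 D) : 2 ≤ Q.a := by
  obtain ⟨a, b, c⟩ := Q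
  obtain ⟨-, hdisc, ha⟩ := hQ
  obtain ⟨hba, -, hb⟩ := hred
  simp only [QF.disc] at *
  by_contra! hlt
  obtain rfl : a = 1 := by omega
  obtain ⟨h1, h2⟩ := abs_le.1 hba
  have hb' : b = 0 ∨ b = 1 := by
    have : b ≠ -1 := by rintro rfl; simp at hb
    omega
  apply hne
  rcases hb' with rfl | rfl
  · rw [Q0, if_pos (by omega), QF.mk.injEq]; omega
  · rw [Q0, if_neg (by omega), QF.mk.injEq]; omega

lemma three_mul_a_sq_le {D : ℤ} {Q : QF} (hQ : IsForm D Q) (hred : IsReducedQF Q) :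
    3 * Q.a ^ 2 ≤ -D := by
  obtain ⟨-, hdisc, ha⟩ := hQ
  obtain ⟨hba, hac, -⟩ := hred
  have h1 : Q.b ^ 2 ≤ Q.a ^ 2 := sq_le_sq.2 (hba.trans (le_abs_self _))
  rw [QF.disc] at hdisc
  nlinarith

lemma fifteen_le_of_ne_Q0 {D : ℤ} {Q : QF} (hQ : IsForm D Q) (hred : IsReducedQF Q)
    (hne : Q ≠ Q0 D) : 15 ≤ -D := by
  have h2 := two_le_a_of_ne_Q0 hQ hred hne
  have h3 := three_mul_a_sq_le hQ hred
  obtain ha | ha := h2.eq_or_lt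
  · obtain ⟨a, b, c⟩ := Q
    obtain ⟨hgcd, hdisc, -⟩ := hQ
    obtain ⟨hba, hac, -⟩ := hred
    simp only [QF.disc] at *
    subst ha
    obtain ⟨hb1, hb2⟩ := abs_le.1 hba
    by_contra! hlt
    have hc : c = 2 := by nlinarith
    subst hc
    interval_cases b
    all_goals first | (exfalso; revert hgcd; decide) | omega
  · nlinarith

lemma four_hundred_le_exp {d : ℝ} (hd : 15 ≤ d) : 400 ≤ Real.exp (Real.pi * √d / 2) := by
  have hs : 3.87 ≤ √d := Real.le_sqrt_of_sq_le (by linarith)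
  have h6 : (6 : ℝ) ≤ Real.pi * √d / 2 := by
    nlinarith [Real.pi_gt_d2]
  calc (400 : ℝ) ≤ 2.718 ^ 6 := by norm_num
    _ ≤ Real.exp 1 ^ 6 := by gcongr; linarith [Real.exp_one_gt_d9]
    _ = Real.exp 6 := by rw [← Real.exp_nat_mul]; norm_num
    _ ≤ _ := Real.exp_le_exp.2 h6

lemma exp_five_four_ge : 220 ≤ Real.exp 5.4 := by
  refine le_of_pow_le_pow_left₀ (n := 5) (by norm_num) (by positivity) ?_
  calc (220 : ℝ) ^ 5 ≤ 2.718 ^ 27 := by norm_num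
    _ ≤ Real.exp 1 ^ 27 := by gcongr; linarith [Real.exp_one_gt_d9]
    _ = _ := by rw [← Real.exp_nat_mul, ← Real.exp_nat_mul]; norm_num

/-!
STATEMENT 13: if `h_O ≥ 2` and `Q` is a reduced form in `𝒬(D_O)` with `Q ≠ Q₀`, then
`|j(ω_Q)²(j(ω_Q) - 1728)³| / |j(ω_{Q₀})²(j(ω_{Q₀}) - 1728)³| < 877383 e^{-5π√|D_O|/2} < 1`.
-/

theorem statement13 (D : ℤ) (hD : D < 0) (hD4 : D % 4 = 0 ∨ D % 4 = 1)
    (hclass : 2 ≤ classNum (OD D))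
    (Q : QF) (hQ : IsForm D Q) (hred : IsReducedQF Q) (hne : Q ≠ Q0 D) :
    ‖jinv (omegaQ D Q) ^ 2 * (jinv (omegaQ D Q) - 1728) ^ 3‖ /
        ‖jinv (omegaQ D (Q0 D)) ^ 2 * (jinv (omegaQ D (Q0 D)) - 1728) ^ 3‖ <
      877383 * Real.exp (-(5 * Real.pi * Real.sqrt (Int.natAbs D)) / 2) ∧
    877383 * Real.exp (-(5 * Real.pi * Real.sqrt (Int.natAbs D)) / 2) < 1 := by
  have ha2 := two_le_a_of_ne_Q0 hQ hred hne
  have ha2' : (2 : ℝ) ≤ Q.a := by exact_mod_cast ha2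
  have hd : (((Int.natAbs D : ℕ) : ℝ)) = -(D : ℝ) := by
    rw [Nat.cast_natAbs, Int.cast_abs, abs_of_neg (by exact_mod_cast hD)]
  have h15 : (15 : ℝ) ≤ (Int.natAbs D : ℕ) := by
    rw [hd]; exact_mod_cast fifteen_le_of_ne_Q0 hQ hred hne
  have h3a : 3 * (Q.a : ℝ) ^ 2 ≤ (Int.natAbs D : ℕ) := by
    rw [hd]; exact_mod_cast three_mul_a_sq_le hQ hred
  have hq := norm_exp_omegaQ D hQ.2.2
  have hq0 := norm_exp_omegaQ D (Q := Q0 D) (by rw [Q0_a]; norm_num)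
  generalize ((Int.natAbs D : ℕ) : ℝ) = d at *
  have hy := four_hundred_le_exp h15
  have hx0 : Real.exp (Real.pi * √d / (Q0 D).a) = Real.exp (Real.pi * √d / 2) ^ 2 := by
    rw [Q0_a, ← Real.exp_nat_mul]; congr 1; push_cast; ring
  have hx : 220 ≤ Real.exp (Real.pi * √d / Q.a) := by
    refine exp_five_four_ge.trans (Real.exp_le_exp.2 ?_)
    have hs : 1.732 * (Q.a : ℝ) ≤ √d := Real.le_sqrt_of_sq_le (by nlinarith)
    rw [le_div_iff₀ (by linarith)]
    nlinarith [Real.pi_gt_d2]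
  have hxy : Real.exp (Real.pi * √d / Q.a) ≤ Real.exp (Real.pi * √d / 2) := by
    gcongr
  have hb : Real.exp (-(5 * Real.pi * √d) / 2) = (Real.exp (Real.pi * √d / 2) ^ 5)⁻¹ := by
    rw [← Real.exp_nat_mul, ← Real.exp_neg]; congr 1; push_cast; ring
  rw [hx0] at hq0
  rw [hb]
  generalize Real.exp (Real.pi * √d / 2) = y at *
  have hN := norm_jinv_expr_le_of_large hx hy hxy hq
  have hN0 := le_norm_jinv_expr_of_large (by nlinarith) hq0
  have hy5 : (400 : ℝ) ^ 5 ≤ y ^ 5 := by gcongr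
  have hypos : 0 < y := by linarith
  constructor
  · rw [div_lt_iff₀ (lt_of_lt_of_le (by positivity) hN0)]
    calc _ ≤ 240000 * y ^ 5 := hN
      _ < 877383 * (y ^ 5)⁻¹ * (0.54 * (y ^ 2) ^ 5) := by
        have : 877383 * (y ^ 5)⁻¹ * (0.54 * (y ^ 2) ^ 5) = 877383 * 0.54 * y ^ 5 := by
          field_simp
        rw [this]
        gcongr
        norm_num
      _ ≤ _ := by gcongr
  · rw [← div_eq_mul_inv, div_lt_one (by positivity)]
    linarith
end
end

section
/- Let K be an imaginary quadratic field, O an order in K of discriminant D_O, and N a positive integer. Let C ∈ C_N(O) and write C = [ℤω_Q + ℤ] for some Q = ax² + bxy + cy² ∈ Q(D_O, N), and let a' be an integer with aa' ≡ 1 (mod N). Then for every complex s with Re(s) > 1, the absolutely convergent series ζ_O(s, C) := Σ_{𝔞 ∈ C ∩ M(O,N)} N_O(𝔞)^{−s} satisfies ζ_O(s, C) = (1/(γ_{O,N} · (N²a)^s)) · Σ |m(−ω̄_Q) + n + a'/N|^{−2s}, the last sum running over all pairs (m, n) ∈ ℤ² with m(−ω̄_Q) + n + a'/N ≠ 0,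 where ω̄_Q is the complex conjugate of ω_Q. -/
open scoped nonZeroDivisors

set_option synthInstance.maxHeartbeats 1000000
set_option maxHeartbeats 1000000

noncomputable section

/-- `γ_{O,N} = #{ν ∈ O^× : ν ≡ 1 (mod NO)}`. -/
def gammaON (O : Subalgebra ℤ ℂ) (N : ℕ) : ℕ :=
  Nat.card {ν : ((O : Type))ˣ // ∃ μ : (O : Type), (ν : (O : Type)) = 1 + (N : (O : Type)) * μ}

/-- The norm `N_O(𝔞) = |O/𝔞|`. -/
def idealNorm (O : Subalgebra ℤ ℂ) (a : Ideal O) : ℕ := Nat.card ((O : Type) ⧸ a)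

/-- The proper `O`-ideals prime to `N` lying in the class `C ∈ C_N(O)`. -/
def classIdeals (O : Subalgebra ℤ ℂ) (N : ℕ) (C : ClsGrp O N) : Set (Ideal O) :=
  {a | a ∈ Mset O N ∧ ∃ (u : (Frac O)ˣ) (hu : u ∈ Igrp O N),
    (u : Frac O) = (a : Frac O) ∧ QuotientGroup.mk ⟨u, hu⟩ = C}

lemma sqrtD_sq {D : ℤ} (hD : D < 0) : sqrtD D ^ 2 = D := by
  have h : ((Real.sqrt (Int.natAbs D) : ℝ) : ℂ) ^ 2 = -(D : ℂ) := by
    rw [← Complex.ofReal_pow, Real.sq_sqrt (Nat.cast_nonneg _)]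
    have : ((D.natAbs : ℤ)) = -D := by omega
    rw [Complex.ofReal_natCast, ← Int.cast_natCast, this]
    push_cast; ring
  rw [sqrtD, mul_pow, Complex.I_sq, h]; ring

lemma sqrtD_im_pos {D : ℤ} (hD : D < 0) : 0 < (sqrtD D).im := by
  simp [sqrtD, Real.sqrt_pos]; omega

lemma conj_sqrtD (D : ℤ) : (starRingEnd ℂ) (sqrtD D) = -sqrtD D := by
  simp [sqrtD]

section Form

variable {D : ℤ} {Q : QF}

lemma omegaQ_sq (hD : D < 0) (hQ : IsForm D Q) :
    (Q.a : ℂ) * omegaQ D Q ^ 2 + Q.b * omegaQ D Q + Q.c = 0 := by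
  have ha : (Q.a : ℂ) ≠ 0 := by exact_mod_cast hQ.2.2.ne'
  have h := sqrtD_sq hD
  have hd : (Q.b : ℂ) ^ 2 - 4 * Q.a * Q.c = D := by exact_mod_cast hQ.2.1
  rw [omegaQ]; field_simp
  linear_combination h - hd

lemma omegaQ_im_pos (hD : D < 0) (hQ : IsForm D Q) : 0 < (omegaQ D Q).im := by
  have ha : (0 : ℝ) < 2 * Q.a := by exact_mod_cast mul_pos two_pos hQ.2.2
  have : omegaQ D Q = ((2 * Q.a : ℝ)⁻¹ : ℝ) * (-(Q.b : ℂ) + sqrtD D) := by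
    rw [omegaQ]; push_cast; field_simp
  rw [this, Complex.im_ofReal_mul]
  have := sqrtD_im_pos hD
  simp only [Complex.add_im, Complex.neg_im, Complex.intCast_im]
  positivity

lemma conj_omegaQ (hQ : IsForm D Q) :
    (Q.a : ℂ) * (starRingEnd ℂ) (omegaQ D Q) = -Q.b - Q.a * omegaQ D Q := by
  have ha : (Q.a : ℂ) ≠ 0 := by exact_mod_cast hQ.2.2.ne'
  simp only [omegaQ, map_div₀, map_add, map_neg, map_mul, map_intCast, conj_sqrtD,
    map_ofNat]
  field_simp; ring

lemma mul_omegaQ_im_ne_zero (hD : D < 0) (hQ : IsForm D Q) : ((Q.a : ℂ) * omegaQ D Q).im ≠ 0 := by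
  have ha : (0 : ℝ) < Q.a := by exact_mod_cast hQ.2.2
  have := omegaQ_im_pos hD hQ
  have h : ((Q.a : ℂ) * omegaQ D Q).im = Q.a * (omegaQ D Q).im := by simp
  rw [h]; positivity

lemma int_comb_inj {θ : ℂ} (hθ : θ.im ≠ 0) {x y x' y' : ℤ}
    (h : (x : ℂ) + y * θ = x' + y' * θ) : x = x' ∧ y = y' := by
  have h2 := congrArg Complex.im h
  simp at h2
  have hy : y = y' := h2.resolve_right hθ
  subst hy
  exact ⟨by exact_mod_cast add_right_cancel h, rfl⟩

lemma tauD_eq (hQ : IsForm D Q) :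
    ∃ k : ℤ, tauD D = k + Q.a * omegaQ D Q := by
  have ha : (Q.a : ℂ) ≠ 0 := by exact_mod_cast hQ.2.2.ne'
  have hd : Q.b ^ 2 - 4 * Q.a * Q.c = D := hQ.2.1
  have key : (Q.a : ℂ) * omegaQ D Q = (-(Q.b : ℂ) + sqrtD D) / 2 := by
    rw [omegaQ]; field_simp
  have hmod : Q.b ^ 2 % 4 = D % 4 := by
    rw [← hd, mul_assoc, Int.sub_mul_emod_self_left]
  obtain ⟨k, hk | hk⟩ := Int.even_or_odd' Q.b
  · have h0 : D % 4 = 0 := by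
      rw [← hmod, hk, show (2 * k) ^ 2 = 4 * k ^ 2 by ring]; omega
    refine ⟨k, ?_⟩
    rw [tauD, if_pos h0, key, hk]; push_cast; ring
  · have h0 : ¬ D % 4 = 0 := by
      rw [← hmod, hk, show (2 * k + 1) ^ 2 = 4 * (k ^ 2 + k) + 1 by ring]; omega
    refine ⟨k, ?_⟩
    rw [tauD, if_neg h0, key, hk]; push_cast; ring

lemma mem_OD (hD : D < 0) (hQ : IsForm D Q) (z : ℂ) :
    z ∈ OD D ↔ ∃ x y : ℤ, z = x + y * (Q.a * omegaQ D Q) := by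
  obtain ⟨k, hk⟩ := tauD_eq hQ
  have hτ : tauD D ∈ OD D := Algebra.subset_adjoin rfl
  have hint : ∀ x : ℤ, (x : ℂ) ∈ OD D := fun x => by
    exact (OD D).algebraMap_mem x
  have hsq : (Q.a * omegaQ D Q) ^ 2 = -Q.b * (Q.a * omegaQ D Q) - Q.a * Q.c := by
    linear_combination (Q.a : ℂ) * omegaQ_sq hD hQ
  constructor
  · intro h
    induction h using Algebra.adjoin_induction with
    | mem x hx =>
      rw [Set.mem_singleton_iff] at hx
      exact ⟨k, 1, by rw [hx, hk]; simp⟩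
    | algebraMap r => exact ⟨r, 0, by simp⟩
    | add x y _ _ hx hy =>
      obtain ⟨a, b, rfl⟩ := hx
      obtain ⟨c, d, rfl⟩ := hy
      exact ⟨a + c, b + d, by push_cast; ring⟩
    | mul x y _ _ hx hy =>
      obtain ⟨p, q, rfl⟩ := hx
      obtain ⟨r, t, rfl⟩ := hy
      refine ⟨p * r - q * t * Q.a * Q.c, p * t + q * r - q * t * Q.b, ?_⟩
      push_cast
      linear_combination (q : ℂ) * t * hsq
  · rintro ⟨x, y, rfl⟩
    have hθ : (Q.a : ℂ) * omegaQ D Q = tauD D - k := by rw [hk]; ring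
    rw [hθ]
    exact add_mem (hint x) (mul_mem (hint y) (sub_mem hτ (hint k)))

end Form

lemma idealNorm_eq_det {O : Subalgebra ℤ ℂ} {θ : ℂ} (hθ : θ.im ≠ 0)
    (hO : ∀ z, z ∈ O ↔ ∃ x y : ℤ, z = x + y * θ) (I : Ideal O) (P R S T : ℤ)
    (hdet : P * T - R * S ≠ 0)
    (hI : ∀ x : O, x ∈ I ↔ ∃ m n : ℤ, (x : ℂ) = m * (P + R * θ) + n * (S + T * θ)) :
    idealNorm O I = (P * T - R * S).natAbs := by
  have hθO : θ ∈ O := (hO θ).2 ⟨0, 1, by simp⟩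
  have hu : (P + R * θ : ℂ) ∈ O := (hO _).2 ⟨P, R, rfl⟩
  have hv : (S + T * θ : ℂ) ∈ O := (hO _).2 ⟨S, T, rfl⟩
  let u : O := ⟨_, hu⟩
  let v : O := ⟨_, hv⟩
  have huI : u ∈ I := (hI u).2 ⟨1, 0, by simp [u]⟩
  have hvI : v ∈ I := (hI v).2 ⟨0, 1, by simp [v]⟩
  let bO : Module.Basis (Fin 2) ℤ O := Module.Basis.mk (v := ![1, ⟨θ, hθO⟩])
    (by
      rw [LinearIndependent.pair_iff]
      intro s t h
      have h' := congrArg (Subtype.val) h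
      simp at h'
      exact int_comb_inj hθ (x' := 0) (y' := 0) (by simpa using h'))
    (by
      rintro ⟨x, hx⟩ -
      obtain ⟨m, n, rfl⟩ := (hO x).1 hx
      simp only [Matrix.range_cons, Matrix.range_empty, Set.union_empty, Set.singleton_union]
      rw [Submodule.mem_span_pair]
      exact ⟨m, n, Subtype.ext (by simp)⟩)
  let J : Submodule ℤ O := I.restrictScalars ℤ
  let bI : Module.Basis (Fin 2) ℤ J := Module.Basis.mk (v := ![⟨u, huI⟩, ⟨v, hvI⟩])
    (by
      rw [LinearIndependent.pair_iff]
      intro s t h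
      have h' := congrArg (fun x : J => ((x : O) : ℂ)) h
      simp [u, v] at h'
      obtain ⟨e1, e2⟩ := int_comb_inj hθ (x := s * P + t * S) (y := s * R + t * T)
        (x' := 0) (y' := 0) (by push_cast; linear_combination h')
      constructor
      · apply (mul_eq_zero.1 (_ : s * (P * T - R * S) = 0)).resolve_right hdet
        linear_combination T * e1 - S * e2
      · apply (mul_eq_zero.1 (_ : t * (P * T - R * S) = 0)).resolve_right hdet
        linear_combination P * e2 - R * e1)
    (by
      rintro ⟨x, hx⟩ -
      obtain ⟨m, n, h⟩ := (hI x).1 hx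
      simp only [Matrix.range_cons, Matrix.range_empty, Set.union_empty, Set.singleton_union]
      rw [Submodule.mem_span_pair]
      exact ⟨m, n, Subtype.ext (Subtype.ext (by simp [u, v, h]; ring))⟩)
  have : Module.Free ℤ O := Module.Free.of_basis bO
  have : Module.Finite ℤ O := Module.Finite.of_basis bO
  have key := Submodule.natAbs_det_basis_change bO J bI
  have hr : ∀ x y : ℤ, ∀ z : O, (z : ℂ) = x + y * θ → bO.repr z 0 = x ∧ bO.repr z 1 = y := by
    intro x y z hz
    have : z = x • bO 0 + y • bO 1 := Subtype.ext (by simp [bO, hz])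
    rw [this, map_add, map_smul, map_smul, Module.Basis.repr_self, Module.Basis.repr_self]
    simp
  have hd : bO.det (Subtype.val ∘ bI) = P * T - R * S := by
    rw [Module.Basis.det_apply, Matrix.det_fin_two]
    simp only [Module.Basis.toMatrix_apply, Function.comp]
    have e0 : ((bI 0 : J) : O) = u := by simp [bI]
    have e1 : ((bI 1 : J) : O) = v := by simp [bI]
    rw [e0, e1, (hr P R u rfl).1, (hr P R u rfl).2, (hr S T v rfl).1, (hr S T v rfl).2]
    ring
  rw [idealNorm, ← hd, key]
  rfl

section ClassGroup

variable {O : Subalgebra ℤ ℂ} {N : ℕ}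

lemma mem_span_singleton_mul_frac (ν : O) (J : Frac O) (z : ℂ) :
    z ∈ ((((Ideal.span {ν} : Ideal O) : Frac O) * J : Frac O) : Submodule O ℂ) ↔
      ∃ l ∈ (J : Submodule O ℂ), (ν : ℂ) * l = z := by
  rw [FractionalIdeal.coe_mul, FractionalIdeal.coe_coeIdeal,
    IsLocalization.coeSubmodule_span_singleton, Submodule.mem_span_singleton_mul]
  rfl

lemma exists_unit_span_singleton {ν : O} (hν : ν ≠ 0) :
    ∃ w : (Frac O)ˣ, (w : Frac O) = ((Ideal.span {ν} : Ideal O) : Frac O) := by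
  have hν' : (ν : ℂ) ≠ 0 := fun h => hν (Subtype.ext h)
  let J : Frac O := ⟨Submodule.span O {(ν : ℂ)⁻¹}, ν, mem_nonZeroDivisors_of_ne_zero hν, by
    intro b hb
    obtain ⟨r, rfl⟩ := Submodule.mem_span_singleton.1 hb
    refine ⟨r, ?_⟩
    change (r : ℂ) = (ν : ℂ) * ((r : ℂ) * (ν : ℂ)⁻¹)
    field_simp⟩
  refine ⟨Units.mkOfMulEqOne ((Ideal.span {ν} : Ideal O) : Frac O) J ?_, rfl⟩
  apply FractionalIdeal.coe_ext
  ext z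
  rw [mem_span_singleton_mul_frac, FractionalIdeal.coe_one, Submodule.mem_one]
  constructor
  · rintro ⟨l, hl, rfl⟩
    obtain ⟨r, rfl⟩ := Submodule.mem_span_singleton.1 hl
    refine ⟨r, ?_⟩
    change (r : ℂ) = (ν : ℂ) * ((r : ℂ) * (ν : ℂ)⁻¹)
    field_simp
  · rintro ⟨r, rfl⟩
    refine ⟨_, Submodule.mem_span_singleton.2 ⟨r, rfl⟩, ?_⟩
    change (ν : ℂ) * ((r : ℂ) * (ν : ℂ)⁻¹) = (r : ℂ)
    field_simp

lemma exists_of_mem_Pgrp {w : (Frac O)ˣ} (hw : w ∈ Pgrp O N) :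
    ∃ α β : O, α ≠ 0 ∧ β ≠ 0 ∧ (∃ μ, α = 1 + (N : O) * μ) ∧ (∃ μ, β = 1 + (N : O) * μ) ∧
      ((Ideal.span {β} : Ideal O) : Frac O) * (w : Frac O) = ((Ideal.span {α} : Ideal O) : Frac O) := by
  induction hw using Subgroup.closure_induction with
  | mem w hw =>
    obtain ⟨ν, h0, h1, h2⟩ := hw
    refine ⟨ν, 1, h0, one_ne_zero, h1, ⟨0, by simp⟩, ?_⟩
    rw [h2, ← FractionalIdeal.coeIdeal_mul, Ideal.span_singleton_mul_span_singleton, one_mul]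
  | one =>
    exact ⟨1, 1, one_ne_zero, one_ne_zero, ⟨0, by simp⟩, ⟨0, by simp⟩, by simp⟩
  | mul v w _ _ hv hw =>
    obtain ⟨α, β, hα, hβ, ⟨μ, hμ⟩, ⟨ρ, hρ⟩, h⟩ := hv
    obtain ⟨α', β', hα', hβ', ⟨μ', hμ'⟩, ⟨ρ', hρ'⟩, h'⟩ := hw
    refine ⟨α * α', β * β', mul_ne_zero hα hα', mul_ne_zero hβ hβ',
      ⟨μ + μ' + N * μ * μ', by rw [hμ, hμ']; ring⟩,
      ⟨ρ + ρ' + N * ρ * ρ', by rw [hρ, hρ']; ring⟩, ?_⟩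
    rw [← Ideal.span_singleton_mul_span_singleton, ← Ideal.span_singleton_mul_span_singleton,
      FractionalIdeal.coeIdeal_mul, FractionalIdeal.coeIdeal_mul, ← h, ← h', Units.val_mul]
    ring
  | inv w _ hw =>
    obtain ⟨α, β, hα, hβ, h1, h2, h⟩ := hw
    exact ⟨β, α, hβ, hα, h2, h1, by rw [← h, mul_assoc, Units.mul_inv, mul_one]⟩

lemma exists_of_mem_classIdeals {u : (Frac O)ˣ} (hu : u ∈ Igrp O N) {a : Ideal O}
    (ha : a ∈ classIdeals O N (QuotientGroup.mk ⟨u, hu⟩)) :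
    ∃ α β : O, α ≠ 0 ∧ β ≠ 0 ∧ (∃ μ, α = 1 + (N : O) * μ) ∧ (∃ μ, β = 1 + (N : O) * μ) ∧
      ∀ z : ℂ, (∃ x ∈ a, (β : ℂ) * x = z) ↔ ∃ l ∈ fracSet u, (α : ℂ) * l = z := by
  obtain ⟨-, v, hv, hva, hC⟩ := ha
  rw [eq_comm, QuotientGroup.eq, Subgroup.mem_subgroupOf] at hC
  obtain ⟨α, β, hα, hβ, h1, h2, h⟩ := exists_of_mem_Pgrp hC
  refine ⟨α, β, hα, hβ, h1, h2, fun z => ?_⟩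
  have e : ((Ideal.span {β} : Ideal O) : Frac O) * (a : Frac O)
      = ((Ideal.span {α} : Ideal O) : Frac O) * (u : Frac O) := by
    rw [← h, ← hva]
    simp only [Subgroup.coe_mul, Subgroup.coe_inv, Units.val_mul]
    rw [mul_assoc, mul_right_comm, Units.inv_mul, one_mul]
  have e' := congrArg (fun J : Frac O => z ∈ (J : Submodule O ℂ)) e
  simp only [mem_span_singleton_mul_frac, eq_iff_iff] at e'
  refine Iff.trans ?_ e'
  constructor
  · rintro ⟨x, hx, hz⟩
    exact ⟨x, ⟨x, hx, rfl⟩, hz⟩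
  · rintro ⟨-, ⟨x, hx, rfl⟩, hz⟩
    exact ⟨x, hx, hz⟩

lemma exists_classIdeal {u : (Frac O)ˣ} (hu : u ∈ Igrp O N) (h1 : (1 : ℂ) ∈ fracSet u) {ν : O}
    (hν : ν ≠ 0) (hνN : ∃ μ, ν = 1 + (N : O) * μ) (hνu : ∀ l ∈ fracSet u, (ν : ℂ) * l ∈ O) :
    ∃ a : classIdeals O N (QuotientGroup.mk ⟨u, hu⟩),
      ∀ x : O, x ∈ a.1 ↔ ∃ l ∈ fracSet u, (ν : ℂ) * l = x := by
  let a : Ideal O :=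
    { carrier := {x | ∃ l ∈ fracSet u, (ν : ℂ) * l = x}
      add_mem' := by
        rintro x y ⟨l, hl, hx⟩ ⟨k, hk, hy⟩
        exact ⟨l + k, add_mem (S := Submodule O ℂ) hl hk, by rw [mul_add, hx, hy]; rfl⟩
      zero_mem' := ⟨0, zero_mem (S := Submodule O ℂ) _, by simp⟩
      smul_mem' := by
        rintro r x ⟨l, hl, hx⟩
        refine ⟨r • l, Submodule.smul_mem _ r hl, ?_⟩
        change (ν : ℂ) * ((r : ℂ) * l) = r * x
        rw [← hx]; ring }
  have ha : ∀ x : O, x ∈ a ↔ ∃ l ∈ fracSet u, (ν : ℂ) * l = x := fun x => Iff.rfl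
  obtain ⟨w, hw⟩ := exists_unit_span_singleton hν
  have hwa : ((w * u : (Frac O)ˣ) : Frac O) = a := by
    apply FractionalIdeal.coe_ext
    ext z
    rw [Units.val_mul, hw, mem_span_singleton_mul_frac, FractionalIdeal.coe_coeIdeal]
    constructor
    · rintro ⟨l, hl, rfl⟩
      exact ⟨⟨_, hνu l hl⟩, (ha _).2 ⟨l, hl, rfl⟩, rfl⟩
    · rintro ⟨x, hx, rfl⟩
      exact (ha x).1 hx
  have hνa : ν ∈ a := (ha ν).2 ⟨1, h1, mul_one _⟩
  have hM : a ∈ Mset O N := by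
    refine ⟨fun h => hν ?_, ?_, hwa ▸ (w * u).isUnit⟩
    · rw [h] at hνa; exact hνa
    · obtain ⟨μ, hμ⟩ := hνN
      rw [primeTo, Ideal.eq_top_iff_one]
      have : (1 : O) = ν + (N : O) * (-μ) := by rw [hμ]; ring
      rw [this]
      exact Submodule.add_mem_sup hνa (Ideal.mul_mem_right _ _ (Ideal.mem_span_singleton_self _))
  have hI : w * u ∈ Igrp O N := Subgroup.subset_closure ⟨a, hM, hwa⟩
  refine ⟨⟨a, hM, w * u, hI, hwa, ?_⟩, ha⟩
  rw [eq_comm, QuotientGroup.eq, Subgroup.mem_subgroupOf]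
  have hP : w ∈ Pgrp O N := Subgroup.subset_closure ⟨ν, hν, hνN, hw⟩
  have : ((⟨u, hu⟩⁻¹ * ⟨w * u, hI⟩ : Igrp O N) : (Frac O)ˣ) = w := by
    simp [mul_comm w u]
  rwa [this]

end ClassGroup

/-- The point `m (-ω̄_Q) + n + a'/N` of the shifted lattice. -/
def shiftedPt (D : ℤ) (N : ℕ) (Q : QF) (a' : ℤ) (p : ℤ × ℤ) : ℂ :=
  (p.1 : ℂ) * (-(starRingEnd ℂ) (omegaQ D Q)) + (p.2 : ℂ) + (a' : ℂ) / (N : ℂ)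

/-- The multiplier `aN (m (-ω̄_Q) + n + a'/N)`. -/
def shiftedGen (D : ℤ) (N : ℕ) (Q : QF) (a' : ℤ) (p : ℤ × ℤ) : ℂ :=
  Q.a * N * shiftedPt D N Q a' p

section Gen

variable {D : ℤ} {N : ℕ} {Q : QF} {a' : ℤ}

lemma shiftedGen_eq (hN : 0 < N) (hQ : IsForm D Q) (p : ℤ × ℤ) :
    shiftedGen D N Q a' p = ((N * p.1 * Q.b + Q.a * (N * p.2 + a') : ℤ) : ℂ) +
      ((N * p.1 : ℤ) : ℂ) * (Q.a * omegaQ D Q) := by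
  have hN' : (N : ℂ) ≠ 0 := by exact_mod_cast hN.ne'
  rw [shiftedGen, shiftedPt]
  push_cast
  field_simp
  linear_combination (-(p.1 : ℂ) * N) * conj_omegaQ hQ

lemma shiftedGen_mul_omegaQ (hD : D < 0) (hN : 0 < N) (hQ : IsForm D Q) (p : ℤ × ℤ) :
    shiftedGen D N Q a' p * omegaQ D Q = ((-(Q.c * N * p.1) : ℤ) : ℂ) +
      ((N * p.2 + a' : ℤ) : ℂ) * (Q.a * omegaQ D Q) := by
  rw [shiftedGen_eq hN hQ]
  push_cast
  linear_combination (p.1 : ℂ) * N * omegaQ_sq hD hQ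

lemma shiftedGen_modEq_one (hD : D < 0) (hN : 0 < N) (hQ : IsForm D Q)
    (ha' : (N : ℤ) ∣ Q.a * a' - 1) (p : ℤ × ℤ) :
    ∃ μ ∈ OD D, shiftedGen D N Q a' p = 1 + N * μ := by
  obtain ⟨k, hk⟩ := ha'
  refine ⟨_, (mem_OD hD hQ _).2 ⟨p.1 * Q.b + Q.a * p.2 + k, p.1, rfl⟩, ?_⟩
  rw [shiftedGen_eq hN hQ]
  have hk' : (Q.a : ℂ) * a' - 1 = N * k := by exact_mod_cast hk
  push_cast
  linear_combination hk'

lemma exists_shiftedGen_eq (hD : D < 0) (hN : 0 < N) (hQ : IsForm D Q)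
    (ha' : (N : ℤ) ∣ Q.a * a' - 1) {z : ℂ} (hz : ∃ μ ∈ OD D, z = 1 + N * μ)
    (hzω : z * omegaQ D Q ∈ OD D) : ∃ p, shiftedGen D N Q a' p = z := by
  obtain ⟨μ, hμ, rfl⟩ := hz
  obtain ⟨P, R, rfl⟩ := (mem_OD hD hQ _).1 hμ
  obtain ⟨S, T, hST⟩ := (mem_OD hD hQ _).1 hzω
  have ha : (Q.a : ℂ) ≠ 0 := by exact_mod_cast hQ.2.2.ne'
  obtain ⟨-, h2⟩ := int_comb_inj (mul_omegaQ_im_ne_zero hD hQ) (x := Q.a * S) (y := Q.a * T)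
    (x' := -(N * R * Q.a * Q.c)) (y' := 1 + N * P - N * R * Q.b) (by
      push_cast
      linear_combination (-(Q.a : ℂ)) * hST + (N : ℂ) * R * Q.a * omegaQ_sq hD hQ)
  obtain ⟨k, hk⟩ := ha'
  have hT : T = N * (a' * P - a' * R * Q.b - k * T) + a' := by
    linear_combination a' * h2 - T * hk
  refine ⟨(R, a' * P - a' * R * Q.b - k * T), ?_⟩
  rw [shiftedGen_eq hN hQ]
  dsimp only
  rw [← hT, h2]
  push_cast
  ring

lemma shiftedGen_injective (hD : D < 0) (hN : 0 < N) (hQ : IsForm D Q) :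
    Function.Injective (shiftedGen D N Q a') := by
  intro p q h
  rw [shiftedGen_eq hN hQ, shiftedGen_eq hN hQ] at h
  obtain ⟨h1, h2⟩ := int_comb_inj (mul_omegaQ_im_ne_zero hD hQ) h
  have hN' : (N : ℤ) ≠ 0 := by exact_mod_cast hN.ne'
  have e1 : p.1 = q.1 := mul_left_cancel₀ hN' h2
  rw [e1] at h1
  have e2 : p.2 = q.2 :=
    mul_left_cancel₀ hN' (add_right_cancel (mul_left_cancel₀ hQ.2.2.ne' (add_left_cancel h1)))
  exact Prod.ext e1 e2

lemma normSq_shiftedGen (hD : D < 0) (hN : 0 < N) (hQ : IsForm D Q) (p : ℤ × ℤ) :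
    ‖shiftedGen D N Q a' p‖ ^ 2 =
      Q.a * (((N * p.1 * Q.b + Q.a * (N * p.2 + a')) * (N * p.2 + a') -
        (N * p.1) * (-(Q.c * N * p.1)) : ℤ) : ℝ) := by
  have h : ((‖shiftedGen D N Q a' p‖ ^ 2 : ℝ) : ℂ) = _ :=
    (by push_cast; exact (Complex.mul_conj' (shiftedGen D N Q a' p)).symm)
  apply Complex.ofReal_injective
  rw [h, shiftedGen_eq hN hQ]
  simp only [map_add, map_mul, map_intCast]
  push_cast
  linear_combination ((N * p.1 * Q.b + Q.a * (N * p.2 + a')) * N * p.1 +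
    (N * p.1) ^ 2 * Q.a * omegaQ D Q : ℂ) * conj_omegaQ hQ -
    ((N : ℂ) * p.1) ^ 2 * Q.a * omegaQ_sq hD hQ

lemma mem_OD_of_mul_lattice (hD : D < 0) (hQ : IsForm D Q) {ε : ℂ}
    (h : ∀ l ∈ latticeSet (omegaQ D Q), ε * l ∈ latticeSet (omegaQ D Q)) : ε ∈ OD D := by
  obtain ⟨x, y, h1⟩ := h 1 ⟨0, 1, by simp⟩
  obtain ⟨m, n, h2⟩ := h (omegaQ D Q) ⟨1, 0, by simp⟩
  rw [mul_one] at h1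
  subst h1
  have ha : (Q.a : ℂ) ≠ 0 := by exact_mod_cast hQ.2.2.ne'
  obtain ⟨e1, e2⟩ := int_comb_inj (omegaQ_im_pos hD hQ).ne' (x := -(x * Q.c))
    (y := Q.a * y - x * Q.b) (x' := Q.a * n) (y' := Q.a * m) (by
      push_cast
      linear_combination (Q.a : ℂ) * h2 - x * omegaQ_sq hD hQ)
  have hc : Q.a ∣ x * Q.c := ⟨-n, by linear_combination -e1⟩
  have hb : Q.a ∣ x * Q.b := ⟨y - m, by linear_combination -e2⟩
  have hx : Q.a ∣ x := by
    have hg := hQ.1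
    have : Q.a ∣ x * (Int.gcd Q.b Q.c : ℤ) := by
      rw [Int.gcd_eq_gcd_ab, mul_add, ← mul_assoc, ← mul_assoc]
      exact dvd_add (hb.mul_right _) (hc.mul_right _)
    exact (Int.isCoprime_iff_gcd_eq_one.2 hg).dvd_of_dvd_mul_right this
  obtain ⟨k, rfl⟩ := hx
  exact (mem_OD hD hQ _).2 ⟨y, k, by push_cast; ring⟩

lemma summable_shiftedPt (hD : D < 0) (hN : 0 < N) (hQ : IsForm D Q) {k : ℝ} (hk : 2 < k) :
    Summable (fun p : ℤ × ℤ => ‖shiftedPt D N Q a' p‖ ^ (-k)) := by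
  have hN' : (N : ℂ) ≠ 0 := by exact_mod_cast hN.ne'
  let z : UpperHalfPlane := ⟨-(starRingEnd ℂ) (omegaQ D Q), by
    simpa using omegaQ_im_pos hD hQ⟩
  have h1 : Summable fun x : Fin 2 → ℤ => ‖(x 0 : ℂ) * (z : ℂ) + x 1‖ ^ (-k) :=
    ((EisensteinSeries.summable_one_div_norm_rpow hk).mul_left
      (EisensteinSeries.r z ^ (-k))).of_nonneg_of_le (fun _ => by positivity)
      (EisensteinSeries.summand_bound z (by linarith))
  let φ : ℤ × ℤ → Fin 2 → ℤ := fun p => ![N * p.1, N * p.2 + a']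
  have hφ : Function.Injective φ := by
    intro p q h
    have hNz : (N : ℤ) ≠ 0 := by exact_mod_cast hN.ne'
    have e1 := congrFun h 0
    have e2 := congrFun h 1
    simp only [φ, Matrix.cons_val_zero, Matrix.cons_val_one] at e1 e2
    exact Prod.ext (mul_left_cancel₀ hNz e1) (mul_left_cancel₀ hNz (add_right_cancel e2))
  refine ((h1.comp_injective hφ).mul_left ((N : ℝ) ^ k)).congr fun p => ?_
  have e : (φ p 0 : ℂ) * (z : ℂ) + φ p 1 = N * shiftedPt D N Q a' p := by
    simp only [φ, z, shiftedPt, Matrix.cons_val_zero, Matrix.cons_val_one]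
    push_cast
    field_simp
    ring
  have hNr : (0 : ℝ) < N := by exact_mod_cast hN
  rw [Function.comp_apply, e, norm_mul, Complex.norm_natCast,
    Real.mul_rpow hNr.le (norm_nonneg _), ← mul_assoc, ← Real.rpow_add hNr]
  simp

end Gen

/-!
STATEMENT 14: let `C ∈ C_N(O)` with `C = [ℤω_Q + ℤ]` for `Q = ax² + bxy + cy² ∈ 𝒬(D_O, N)`,
and let `a'` be an integer with `aa' ≡ 1 (mod N)`.  For `Re(s) > 1` the series
`ζ_O(s, C) = Σ_{𝔞 ∈ C ∩ M(O,N)} N_O(𝔞)^{-s}` converges absolutely, and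
`ζ_O(s, C) = (1/(γ_{O,N} (N²a)^s)) Σ_{(m,n) ∈ ℤ² ∖ {(0, -a'/N)}} |m(-ω̄_Q) + n + a'/N|^{-2s}`.
-/

theorem statement14 (D : ℤ) (hD : D < 0) (hD4 : D % 4 = 0 ∨ D % 4 = 1) (N : ℕ) (hN : 0 < N)
    (Q : QF) (hQ : IsFormN D N Q) (C : ClsGrp (OD D) N)
    (hC : ∃ (u : (Frac (OD D))ˣ) (hu : u ∈ Igrp (OD D) N),
      fracSet u = latticeSet (omegaQ D Q) ∧ QuotientGroup.mk ⟨u, hu⟩ = C)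
    (a' : ℤ) (ha' : (N : ℤ) ∣ (Q.a * a' - 1))
    (s : ℂ) (hs : 1 < s.re) :
    Summable (fun a : classIdeals (OD D) N C =>
      ‖(idealNorm (OD D) a.1 : ℂ) ^ (-s)‖) ∧
    (∑' a : classIdeals (OD D) N C, (idealNorm (OD D) a.1 : ℂ) ^ (-s)) =
      (1 / ((gammaON (OD D) N : ℂ) * (((N : ℂ) ^ 2 * (Q.a : ℂ)) ^ s))) *
        ∑' p : {p : ℤ × ℤ //
            (p.1 : ℂ) * (-(starRingEnd ℂ) (omegaQ D Q)) + (p.2 : ℂ) + (a' : ℂ) / (N : ℂ) ≠ 0},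
          ((‖(p.1.1 : ℂ) * (-(starRingEnd ℂ) (omegaQ D Q)) + (p.1.2 : ℂ)
              + (a' : ℂ) / (N : ℂ)‖ : ℝ) : ℂ) ^ (-(2 * s)) := by
  have hQ' := hQ.1
  obtain ⟨u, hu, huL, rfl⟩ := hC
  let G := shiftedGen D N Q a'
  have hNr : (0 : ℝ) < N := by exact_mod_cast hN
  have har : (0 : ℝ) < Q.a := by exact_mod_cast hQ'.2.2
  have hG0 : ∀ p, G p = 0 ↔ shiftedPt D N Q a' p = 0 := fun p => by
    have h1 : (Q.a : ℂ) ≠ 0 := by exact_mod_cast hQ'.2.2.ne'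
    have h2 : (N : ℂ) ≠ 0 := by exact_mod_cast hN.ne'
    simp [G, shiftedGen, h1, h2]
  have h1L : (1 : ℂ) ∈ fracSet u := by rw [huL]; exact ⟨0, 1, by simp⟩
  have hωL : omegaQ D Q ∈ fracSet u := by rw [huL]; exact ⟨1, 0, by simp⟩
  have hint : ∀ x y : ℤ, (x : ℂ) + y * (Q.a * omegaQ D Q) ∈ OD D := fun x y =>
    (mem_OD hD hQ' _).2 ⟨x, y, rfl⟩
  have hGO : ∀ p, G p ∈ OD D := fun p => by
    simp only [G]; rw [shiftedGen_eq hN hQ']; exact hint _ _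
  have hGωO : ∀ p, G p * omegaQ D Q ∈ OD D := fun p => by
    simp only [G]; rw [shiftedGen_mul_omegaQ hD hN hQ']; exact hint _ _
  have hsmul : ∀ r ∈ OD D, ∀ l ∈ fracSet u, r * l ∈ fracSet u := fun r hr l hl =>
    Submodule.smul_mem _ (⟨r, hr⟩ : OD D) hl
  have hintO : ∀ x : ℤ, (x : ℂ) ∈ OD D := fun x => (OD D).algebraMap_mem x
  have hGL : ∀ p, ∀ l ∈ fracSet u, G p * l ∈ OD D := fun p l hl => by
    rw [huL] at hl
    obtain ⟨m, n, rfl⟩ := hl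
    have : G p * (m * omegaQ D Q + n) = m * (G p * omegaQ D Q) + n * G p := by ring
    rw [this]
    exact add_mem (mul_mem (hintO m) (hGωO p)) (mul_mem (hintO n) (hGO p))
  let Λ := {p : ℤ × ℤ // shiftedPt D N Q a' p ≠ 0}
  have hGne : ∀ p : Λ, G p.1 ≠ 0 := fun p h => p.2 ((hG0 _).1 h)
  have hf : ∀ p : Λ, ∃ a : classIdeals (OD D) N (QuotientGroup.mk ⟨u, hu⟩),
      ∀ x : OD D, x ∈ a.1 ↔ ∃ l ∈ fracSet u, G p.1 * l = x := fun p => by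
    obtain ⟨μ, hμ, h⟩ := shiftedGen_modEq_one hD hN hQ' ha' p.1
    exact exists_classIdeal hu h1L (ν := ⟨G p.1, hGO p.1⟩)
      (fun h => hGne p (congrArg Subtype.val h)) ⟨⟨μ, hμ⟩, Subtype.ext (by simpa using h)⟩
      (hGL p.1)
  choose f hf using hf
  have hsurj : Function.Surjective f := by
    rintro ⟨a, ha⟩
    obtain ⟨α, β, hα, hβ, ⟨μ, hμ⟩, ⟨ρ, hρ⟩, h⟩ := exists_of_mem_classIdeals hu ha
    have hβ' : (β : ℂ) ≠ 0 := fun h => hβ (Subtype.ext h)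
    have hα' : (α : ℂ) ≠ 0 := fun h => hα (Subtype.ext h)
    obtain ⟨x, hx, hxα⟩ := (h _).2 ⟨1, h1L, rfl⟩
    obtain ⟨y, hy, hyα⟩ := (h _).2 ⟨_, hωL, rfl⟩
    rw [mul_one] at hxα
    have hαβ : α = β * x := Subtype.ext hxα.symm
    have hxN : (x : ℂ) = 1 + N * ((μ - ρ * x : OD D) : ℂ) := by
      have : x = 1 + N * (μ - ρ * x) := by
        linear_combination hμ - hαβ - x * hρ
      simpa using congrArg Subtype.val this
    have hxω : (x : ℂ) * omegaQ D Q = y := by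
      apply mul_left_cancel₀ hβ'
      rw [hyα, ← hxα, mul_assoc]
    obtain ⟨p, hp⟩ := exists_shiftedGen_eq hD hN hQ' ha' ⟨_, (μ - ρ * x).2, hxN⟩
      (hxω ▸ y.2)
    have hp0 : shiftedPt D N Q a' p ≠ 0 := by
      rw [Ne, ← hG0]
      intro h0
      apply hα'
      rw [← hxα, ← hp]
      simp only [G] at h0
      rw [h0, mul_zero]
    refine ⟨⟨p, hp0⟩, Subtype.ext (Ideal.ext fun z => ?_)⟩
    rw [hf]
    change (∃ l ∈ fracSet u, shiftedGen D N Q a' p * l = z) ↔ z ∈ a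
    constructor
    · rintro ⟨l, hl, hz⟩
      obtain ⟨w, hw, hwz⟩ := (h _).2 ⟨l, hl, rfl⟩
      rw [← hxα, mul_assoc, ← hp, hz] at hwz
      rwa [← Subtype.ext (mul_left_cancel₀ hβ' hwz)]
    · intro hz
      obtain ⟨l, hl, hlz⟩ := (h _).1 ⟨z, hz, rfl⟩
      refine ⟨l, hl, mul_left_cancel₀ hβ' ?_⟩
      rw [← hlz, ← hxα, hp, mul_assoc]
  have hnorm : ∀ p : Λ, (idealNorm (OD D) (f p).1 : ℝ) =
      N ^ 2 * Q.a * ‖shiftedPt D N Q a' p.1‖ ^ 2 := fun p => by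
    have h2 := normSq_shiftedGen (a' := a') hD hN hQ' p.1
    have hpos : 0 < ‖shiftedGen D N Q a' p.1‖ ^ 2 := by
      have := norm_pos_iff.2 (hGne p); positivity
    have hdet := pos_of_mul_pos_right (h2 ▸ hpos) har.le
    rw [idealNorm_eq_det (mul_omegaQ_im_ne_zero hD hQ') (mem_OD hD hQ') (f p).1
      (N * p.1.1 * Q.b + Q.a * (N * p.1.2 + a')) (N * p.1.1) (-(Q.c * N * p.1.1))
      (N * p.1.2 + a') (by exact_mod_cast hdet.ne')]
    · apply mul_left_cancel₀ har.ne'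
      rw [Nat.cast_natAbs, abs_of_pos (by exact_mod_cast hdet), ← h2, shiftedGen]
      simp only [norm_mul, Complex.norm_natCast, Complex.norm_intCast, abs_of_pos har]
      ring
    · intro x
      rw [hf, ← shiftedGen_eq hN hQ', ← shiftedGen_mul_omegaQ hD hN hQ', huL]
      constructor
      · rintro ⟨_, ⟨m, n, rfl⟩, h⟩
        exact ⟨n, m, by rw [← h]; ring⟩
      · rintro ⟨m, n, h⟩
        exact ⟨_, ⟨n, m, rfl⟩, by rw [h]; simp only [G]; ring⟩
  let U := {ν : (OD D)ˣ // ∃ μ : OD D, (ν : OD D) = 1 + (N : OD D) * μ}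
  have hfiber : ∀ c, Nonempty (U ≃ {p : Λ // f p = c}) := by
    intro c
    obtain ⟨p₀, rfl⟩ := hsurj c
    have hex : ∀ ν : U, ∃ p : Λ, f p = f p₀ ∧ G p.1 = ((ν.1 : OD D) : ℂ) * G p₀.1 := by
      rintro ⟨ν, μ, hμ⟩
      obtain ⟨ρ, hρO, hρ⟩ := shiftedGen_modEq_one hD hN hQ' ha' p₀.1
      obtain ⟨p, hp⟩ := exists_shiftedGen_eq hD hN hQ' ha'
        (z := ((ν : OD D) : ℂ) * G p₀.1)
        ⟨_, ((ν : OD D) * ⟨ρ, hρO⟩ + μ : OD D).2, by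
          simp only [G]
          rw [hρ, hμ]
          push_cast
          ring⟩
        (by rw [mul_assoc]; exact mul_mem (ν : OD D).2 (hGωO _))
      have hp' : G p = ((ν : OD D) : ℂ) * G p₀.1 := hp
      have hν0 : ((ν : OD D) : ℂ) ≠ 0 := fun h => ν.ne_zero (Subtype.ext h)
      refine ⟨⟨p, fun h => ?_⟩, Subtype.ext (Ideal.ext fun z => ?_), hp'⟩
      · rw [← hG0, hp'] at h
        exact mul_ne_zero hν0 (hGne p₀) h
      · rw [hf, hf]
        have hinv : ((ν : OD D) : ℂ) * ((ν⁻¹ : (OD D)ˣ) : OD D) = 1 :=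
          congrArg Subtype.val (Units.mul_inv ν)
        constructor
        · rintro ⟨l, hl, h⟩
          refine ⟨_, hsmul _ (ν : OD D).2 l hl, ?_⟩
          rw [← h, hp']; ring
        · rintro ⟨l, hl, h⟩
          refine ⟨_, hsmul _ ((ν⁻¹ : (OD D)ˣ) : OD D).2 l hl, ?_⟩
          rw [← h, hp']
          linear_combination G p₀.1 * l * hinv
    choose g hg1 hg2 using hex
    refine ⟨Equiv.ofBijective (fun ν => ⟨g ν, hg1 ν⟩) ⟨?_, ?_⟩⟩
    · intro ν ν' h
      have h' : g ν = g ν' := congrArg Subtype.val h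
      have h2 := hg2 ν
      rw [h', hg2 ν'] at h2
      exact Subtype.ext (Units.ext (Subtype.ext (mul_right_cancel₀ (hGne p₀) h2.symm)))
    · rintro ⟨p, hp⟩
      have hmul : ∀ p q : Λ, f p = f q → G p.1 / G q.1 ∈ OD D := by
        intro p q hpq
        apply mem_OD_of_mul_lattice hD hQ'
        intro l hl
        rw [← huL] at hl ⊢
        have hmem : (⟨_, hGL p.1 l hl⟩ : OD D) ∈ (f p).1 := (hf p _).2 ⟨l, hl, rfl⟩
        rw [hpq, hf] at hmem
        obtain ⟨k, hk, h⟩ := hmem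
        have : G p.1 / G q.1 * l = k := by
          have h' : G q.1 * k = G p.1 * l := h
          rw [div_mul_eq_mul_div, ← h', mul_div_cancel_left₀ _ (hGne q)]
        rwa [this]
      have hp0 := hGne p
      have hp00 := hGne p₀
      let ν : (OD D)ˣ := Units.mkOfMulEqOne ⟨_, hmul p p₀ hp⟩ ⟨_, hmul p₀ p hp.symm⟩
        (Subtype.ext (by
          change G p.1 / G p₀.1 * (G p₀.1 / G p.1) = 1
          field_simp))
      have hν : ((ν : OD D) : ℂ) * G p₀.1 = G p.1 := div_mul_cancel₀ _ hp00
      obtain ⟨ρ, hρO, hρ⟩ := shiftedGen_modEq_one hD hN hQ' ha' p₀.1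
      obtain ⟨σ, hσO, hσ⟩ := shiftedGen_modEq_one hD hN hQ' ha' p.1
      have hνN : ∃ μ : OD D, (ν : OD D) = 1 + (N : OD D) * μ := by
        refine ⟨⟨σ, hσO⟩ - ν * ⟨ρ, hρO⟩, Subtype.ext ?_⟩
        simp only [G] at hν
        rw [hρ, hσ] at hν
        push_cast
        linear_combination hν
      refine ⟨⟨ν, hνN⟩, Subtype.ext (Subtype.ext (shiftedGen_injective (a' := a') hD hN hQ' ?_))⟩
      exact (hg2 ⟨ν, hνN⟩).trans hν
  have hterm : ∀ p : Λ, (idealNorm (OD D) (f p).1 : ℂ) ^ (-s) =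
      (((N : ℂ) ^ 2 * (Q.a : ℂ)) ^ s)⁻¹ *
        ((‖shiftedPt D N Q a' p.1‖ : ℝ) : ℂ) ^ (-(2 * s)) := fun p => by
    have h : (idealNorm (OD D) (f p).1 : ℂ) =
        ((N ^ 2 * Q.a : ℝ) : ℂ) * ((‖shiftedPt D N Q a' p.1‖ ^ 2 : ℝ) : ℂ) := by
      rw [← Complex.ofReal_mul, ← hnorm p, Complex.ofReal_natCast]
    have hr := norm_pos_iff.2 p.2
    rw [h, Complex.mul_cpow_ofReal_nonneg (by positivity) (by positivity), Complex.cpow_neg]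
    congr 1
    · push_cast; rfl
    · have hr' : ((‖shiftedPt D N Q a' p.1‖ : ℝ) : ℂ) ≠ 0 := by exact_mod_cast hr.ne'
      rw [Complex.cpow_def_of_ne_zero hr', Complex.cpow_def_of_ne_zero (by
        exact_mod_cast (pow_pos hr 2).ne'), ← Complex.ofReal_log (by positivity),
        ← Complex.ofReal_log hr.le, Real.log_pow]
      congr 1
      push_cast; ring
  have hsum : Summable fun p : Λ => ‖((‖shiftedPt D N Q a' p.1‖ : ℝ) : ℂ) ^ (-(2 * s))‖ := by
    have h := (summable_shiftedPt (a' := a') hD hN hQ' (k := 2 * s.re) (by linarith)).subtype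
      {p | shiftedPt D N Q a' p ≠ 0}
    refine h.congr fun p => ?_
    rw [Complex.norm_cpow_eq_rpow_re_of_pos (norm_pos_iff.2 p.2)]
    simp
  let g : classIdeals (OD D) N (QuotientGroup.mk ⟨u, hu⟩) → ℂ :=
    fun a => (idealNorm (OD D) a.1 : ℂ) ^ (-s)
  have hgf : Summable fun p : Λ => ‖g (f p)‖ := by
    simp only [g, hterm, norm_mul]
    exact hsum.mul_left _
  have hg : Summable fun a => ‖g a‖ := by
    refine (hgf.comp_injective (Function.injective_surjInv hsurj)).congr fun a => ?_
    simp [Function.surjInv_eq hsurj]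
  have hUfin : Finite U := by
    by_contra hinf
    rw [not_finite_iff_infinite] at hinf
    have hp : shiftedPt D N Q a' (1, 0) ≠ 0 := fun h => by
      have := congrArg Complex.im h
      have hdiv : ((a' : ℂ) / (N : ℂ)).im = 0 := by
        rw [← Complex.ofReal_intCast, ← Complex.ofReal_natCast, ← Complex.ofReal_div,
          Complex.ofReal_im]
      simp [shiftedPt, hdiv] at this
      exact (omegaQ_im_pos hD hQ').ne' this
    obtain ⟨e⟩ := hfiber (f ⟨_, hp⟩)
    have h := hgf.comp_injective (Subtype.val_injective.comp e.injective)
    have h' : Summable fun _ : U => ‖g (f ⟨_, hp⟩)‖ := h.congr fun ν => by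
      rw [Function.comp_apply, Function.comp_apply, (e ν).2]
    rw [summable_const_iff, norm_eq_zero] at h'
    have hn := hnorm ⟨_, hp⟩
    have hr := norm_pos_iff.2 hp
    have hne : (idealNorm (OD D) (f ⟨_, hp⟩).1 : ℂ) ≠ 0 := by
      intro h0
      rw [Nat.cast_eq_zero] at h0
      rw [h0, Nat.cast_zero] at hn
      exact (by positivity : (0 : ℝ) < N ^ 2 * Q.a * ‖shiftedPt D N Q a' (1, 0)‖ ^ 2).ne hn
    exact (Complex.cpow_ne_zero_iff_of_exponent_ne_zero (by
      intro h0
      have := congrArg Complex.re h0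
      simp at this
      linarith)).2 hne h'
  have hγ : (gammaON (OD D) N : ℂ) ≠ 0 := by
    have : Nonempty U := ⟨⟨1, 0, by simp⟩⟩
    exact_mod_cast (Nat.card_pos (α := U)).ne'
  refine ⟨hg, ?_⟩
  have hfib : ∑' p : Λ, g (f p) = gammaON (OD D) N * ∑' a, g a := by
    rw [← (Equiv.sigmaFiberEquiv f).tsum_eq]
    refine (Summable.tsum_sigma ((Equiv.sigmaFiberEquiv f).summable_iff.2 hgf.of_norm)).trans ?_
    rw [← tsum_mul_left]
    refine tsum_congr fun c => ?_
    obtain ⟨e⟩ := hfiber c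
    have : ∀ p : {p : Λ // f p = c}, g (f (Equiv.sigmaFiberEquiv f ⟨c, p⟩)) = g c :=
      fun p => congrArg g p.2
    refine (tsum_congr this).trans ?_
    rw [tsum_const, ← Nat.card_congr e, nsmul_eq_mul]
    rfl
  simp only [g, hterm] at hfib
  rw [tsum_mul_left] at hfib
  rw [one_div, mul_inv, mul_assoc]
  exact ((inv_mul_eq_iff_eq_mul₀ hγ).2 hfib).symm
end
end
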